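/- Strict convexity of the discrete Fisher information on a connected graph: let G be a finite, connected, undirected simple weighted graph and ρ ∈ ℝⁿ with ρ_j > 0 for all j. Then for every nonzero σ ∈ ℝⁿ with Σ_j σ_j = 0, one has σᵀ·Hess I(ρ)·σ > 0. Consequently I is a strictly convex function on the open probability simplex P_o(G). -/

import Mathlib

open Finset

/-- The discrete Fisher information. -/
noncomputable def fisherInfo {n : ℕ} (G : SimpleGraph (Fin n)) [DecidableRel G.Adj]
    (ω : Fin n → Fin n → ℝ) (ρ : Fin n → ℝ) : ℝ :=
  (1 / 2) * ∑ j : Fin n, ∑ l : Fin n,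
    (if G.Adj j l then
      ω j l * (Real.log (ρ j) - Real.log (ρ l)) ^ 2 * ((ρ j + ρ l) / 2) else 0)

/-- The weight `t_{jl}` of an edge in the Hessian of the Fisher information. -/
noncomputable def fisherEdgeWeight (x y : ℝ) : ℝ :=
  (x - y) * (Real.log x - Real.log y) + x + y

lemma fisherEdgeWeight_pos {x y : ℝ} (hx : 0 < x) (hy : 0 < y) :
    0 < fisherEdgeWeight x y := by
  have h : 0 ≤ (x - y) * (Real.log x - Real.log y) := by
    rcases le_total x y with h | h
    · exact mul_nonneg_of_nonpos_of_nonpos (sub_nonpos.2 h)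
        (sub_nonpos.2 (Real.log_le_log hx h))
    · exact mul_nonneg (sub_nonneg.2 h) (sub_nonneg.2 (Real.log_le_log hy h))
  unfold fisherEdgeWeight
  linarith

lemma hasDerivAt_log_add_mul {a b t : ℝ} (h : 0 < a + t * b) :
    HasDerivAt (fun s : ℝ => Real.log (a + s * b)) (b / (a + t * b)) t := by
  simpa using (((hasDerivAt_id t).mul_const b).const_add a).log h.ne'

lemma hasDerivAt_div_add_mul {a b t : ℝ} (h : 0 < a + t * b) :
    HasDerivAt (fun s : ℝ => b / (a + s * b)) (-(b / (a + t * b)) ^ 2) t := by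
  have h1 := ((hasDerivAt_id t).mul_const b).const_add a
  refine ((hasDerivAt_const t b).fun_div h1 h.ne').congr_deriv ?_
  simp only [id]
  field_simp
  ring

/-- The first derivative along a line of the contribution of one edge. -/
noncomputable def fisherEdgeDeriv (a b c d t : ℝ) : ℝ :=
  (Real.log (a + t * b) - Real.log (c + t * d)) * (b / (a + t * b) - d / (c + t * d)) *
      (a + t * b + (c + t * d)) +
    (Real.log (a + t * b) - Real.log (c + t * d)) ^ 2 * ((b + d) / 2)

lemma hasDerivAt_fisherEdge {a b c d t : ℝ} (hx : 0 < a + t * b) (hy : 0 < c + t * d) :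
    HasDerivAt (fun s : ℝ => (Real.log (a + s * b) - Real.log (c + s * d)) ^ 2 *
      ((a + s * b + (c + s * d)) / 2)) (fisherEdgeDeriv a b c d t) t := by
  have hL := (hasDerivAt_log_add_mul hx).fun_sub (hasDerivAt_log_add_mul hy)
  have hS := (((hasDerivAt_id t).mul_const b).const_add a).fun_add
    (((hasDerivAt_id t).mul_const d).const_add c)
  refine ((hL.fun_pow 2).fun_mul (hS.div_const 2)).congr_deriv ?_
  simp only [id, fisherEdgeDeriv]
  push_cast
  ring

lemma hasDerivAt_fisherEdgeDeriv {a b c d t : ℝ} (hx : 0 < a + t * b)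
    (hy : 0 < c + t * d) :
    HasDerivAt (fisherEdgeDeriv a b c d)
      (fisherEdgeWeight (a + t * b) (c + t * d) *
        (b / (a + t * b) - d / (c + t * d)) ^ 2) t := by
  have hL := (hasDerivAt_log_add_mul hx).fun_sub (hasDerivAt_log_add_mul hy)
  have hU := (hasDerivAt_div_add_mul hx).fun_sub (hasDerivAt_div_add_mul hy)
  have hS := (((hasDerivAt_id t).mul_const b).const_add a).fun_add
    (((hasDerivAt_id t).mul_const d).const_add c)
  have key := ((hL.fun_mul hU).fun_mul hS).fun_add ((hL.fun_pow 2).mul_const ((b + d) / 2))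
  refine key.congr_deriv ?_
  simp only [id, fisherEdgeWeight]
  generalize Real.log (a + t * b) - Real.log (c + t * d) = L
  generalize a + t * b = x at *
  generalize c + t * d = y at *
  push_cast
  field_simp
  ring

section Line

variable {n : ℕ} (G : SimpleGraph (Fin n)) [DecidableRel G.Adj] (ω : Fin n → Fin n → ℝ)

/-- The first derivative of the Fisher information along the line `ρ + t σ`. -/
noncomputable def fisherInfoDeriv (ρ σ : Fin n → ℝ) (t : ℝ) : ℝ :=
  (1 / 2) * ∑ j : Fin n, ∑ l : Fin n,
    (if G.Adj j l then ω j l * fisherEdgeDeriv (ρ j) (σ j) (ρ l) (σ l) t else 0)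

/-- The Hessian quadratic form of the Fisher information. -/
noncomputable def fisherInfoHess (ρ σ : Fin n → ℝ) : ℝ :=
  (1 / 2) * ∑ j : Fin n, ∑ l : Fin n,
    (if G.Adj j l then
      ω j l * (fisherEdgeWeight (ρ j) (ρ l) * (σ j / ρ j - σ l / ρ l) ^ 2) else 0)

lemma hasDerivAt_fisherInfo_line {ρ σ : Fin n → ℝ} {t : ℝ}
    (h : ∀ j, 0 < ρ j + t * σ j) :
    HasDerivAt (fun s : ℝ => fisherInfo G ω (fun j => ρ j + s * σ j))
      (fisherInfoDeriv G ω ρ σ t) t := by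
  unfold fisherInfo fisherInfoDeriv
  refine (HasDerivAt.fun_sum fun j _ => HasDerivAt.fun_sum fun l _ => ?_).const_mul _
  split_ifs
  · simp only [mul_assoc (ω j l)]
    exact (hasDerivAt_fisherEdge (h j) (h l)).const_mul _
  · exact hasDerivAt_const _ _

lemma hasDerivAt_fisherInfoDeriv {ρ σ : Fin n → ℝ} {t : ℝ}
    (h : ∀ j, 0 < ρ j + t * σ j) :
    HasDerivAt (fisherInfoDeriv G ω ρ σ)
      (fisherInfoHess G ω (fun j => ρ j + t * σ j) σ) t := by
  unfold fisherInfoDeriv fisherInfoHess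
  refine (HasDerivAt.fun_sum fun j _ => HasDerivAt.fun_sum fun l _ => ?_).const_mul _
  split_ifs
  · exact (hasDerivAt_fisherEdgeDeriv (h j) (h l)).const_mul _
  · exact hasDerivAt_const _ _

lemma deriv_deriv_fisherInfo_line {ρ σ : Fin n → ℝ} {t : ℝ}
    (h : ∀ j, 0 < ρ j + t * σ j) :
    deriv (deriv fun s : ℝ => fisherInfo G ω (fun j => ρ j + s * σ j)) t =
      fisherInfoHess G ω (fun j => ρ j + t * σ j) σ := by
  have hev : ∀ᶠ s in nhds t, ∀ j, 0 < ρ j + s * σ j := by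
    refine Filter.eventually_all.2 fun j => ?_
    have hc : ContinuousAt (fun s : ℝ => ρ j + s * σ j) t := by fun_prop
    exact hc.eventually_const_lt (h j)
  have heq : deriv (fun s : ℝ => fisherInfo G ω (fun j => ρ j + s * σ j)) =ᶠ[nhds t]
      fisherInfoDeriv G ω ρ σ :=
    hev.mono fun s hs => (hasDerivAt_fisherInfo_line G ω hs).deriv
  rw [heq.deriv_eq, (hasDerivAt_fisherInfoDeriv G ω h).deriv]

variable {G ω}

lemma fisherInfoHess_pos (hconn : G.Connected) (hωpos : ∀ j l, G.Adj j l → 0 < ω j l)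
    {ρ : Fin n → ℝ} (hρpos : ∀ j, 0 < ρ j) {σ : Fin n → ℝ} (hσ : σ ≠ 0)
    (hsum : ∑ j, σ j = 0) : 0 < fisherInfoHess G ω ρ σ := by
  have hterm : ∀ j l, 0 ≤ if G.Adj j l then
      ω j l * (fisherEdgeWeight (ρ j) (ρ l) * (σ j / ρ j - σ l / ρ l) ^ 2) else 0 := by
    intro j l
    split_ifs with hjl
    · exact mul_nonneg (hωpos j l hjl).le
        (mul_nonneg (fisherEdgeWeight_pos (hρpos j) (hρpos l)).le (sq_nonneg _))
    · exact le_rfl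
  obtain ⟨j, l, hjl, hne⟩ : ∃ j l, G.Adj j l ∧ σ j / ρ j ≠ σ l / ρ l := by
    by_contra! hall
    have hconst : ∀ j l, σ j / ρ j = σ l / ρ l := by
      intro j l
      obtain ⟨p⟩ := hconn.preconnected j l
      induction p with
      | nil => rfl
      | cons hadj _ ih => exact (hall _ _ hadj).trans ih
    obtain ⟨i⟩ := hconn.nonempty
    have hprop : ∀ j, σ j = σ i / ρ i * ρ j := fun j => by
      rw [← hconst j i, div_mul_cancel₀ _ (hρpos j).ne']
    have hmass : 0 < ∑ j, ρ j := sum_pos (fun j _ => hρpos j) ⟨i, mem_univ i⟩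
    have hzero : σ i / ρ i = 0 := by
      have hmul : σ i / ρ i * ∑ j, ρ j = 0 := by
        rw [mul_sum, ← hsum]
        exact sum_congr rfl fun j _ => (hprop j).symm
      exact (mul_eq_zero.1 hmul).resolve_right hmass.ne'
    exact hσ (funext fun j => by rw [hprop j, hzero, zero_mul, Pi.zero_apply])
  refine mul_pos (by norm_num) (sum_pos' (fun j _ => sum_nonneg fun l _ => hterm j l)
    ⟨j, mem_univ j, sum_pos' (fun l _ => hterm j l) ⟨l, mem_univ l, ?_⟩⟩)
  rw [if_pos hjl]
  exact mul_pos (hωpos j l hjl) (mul_pos (fisherEdgeWeight_pos (hρpos j) (hρpos l))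
    (sq_pos_of_ne_zero (sub_ne_zero.2 hne)))

end Line

/-- strict convexity of the Fisher information on a connected graph: at
any point of the open positive orthant, the Hessian quadratic form of `I` (expressed as
the second derivative of `t ↦ I(ρ + t·σ)` at `t = 0`) is strictly positive on every
nonzero tangent direction `σ` with `Σ_j σ_j = 0`; consequently `I` is strictly convex on
the open probability simplex `P_o(G)`. -/
theorem fisherInfo_strictly_convex {n : ℕ}
    (G : SimpleGraph (Fin n)) [DecidableRel G.Adj] (hconn : G.Connected)
    (ω : Fin n → Fin n → ℝ) (hω : ∀ j l, ω j l = ω l j)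
    (hωpos : ∀ j l, G.Adj j l → 0 < ω j l)
    (ρ : Fin n → ℝ) (hρpos : ∀ j, 0 < ρ j) :
    (∀ σ : Fin n → ℝ, σ ≠ 0 → ∑ j, σ j = 0 →
      0 < iteratedDeriv 2 (fun t : ℝ => fisherInfo G ω (fun j => ρ j + t * σ j)) 0) ∧
    StrictConvexOn ℝ {σ : Fin n → ℝ | (∀ j, 0 < σ j) ∧ ∑ j, σ j = 1}
      (fisherInfo G ω) := by
  have hconv : Convex ℝ {σ : Fin n → ℝ | (∀ j, 0 < σ j) ∧ ∑ j, σ j = 1} := by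
    intro x hx y hy a b ha hb hab
    refine ⟨fun j => convex_Ioi (0 : ℝ) (hx.1 j) (hy.1 j) ha hb hab, ?_⟩
    simp only [Pi.add_apply, Pi.smul_apply, smul_eq_mul, sum_add_distrib, ← mul_sum,
      hx.2, hy.2, mul_one, hab]
  refine ⟨fun σ hσ hsum => ?_, hconv, fun x hx y hy hxy a b ha hb hab => ?_⟩
  · rw [iteratedDeriv_succ, iteratedDeriv_one,
      deriv_deriv_fisherInfo_line G ω (by simpa using hρpos)]
    exact fisherInfoHess_pos hconn hωpos (by simpa using hρpos) hσ hsum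
  · have hpos : ∀ t ∈ Set.Icc (0 : ℝ) 1, ∀ j, 0 < x j + t * (y - x) j := by
      intro t ht j
      have := convex_Ioi (0 : ℝ) (hx.1 j) (hy.1 j) (sub_nonneg.2 ht.2) ht.1
        (sub_add_cancel 1 t)
      simp only [Set.mem_Ioi, smul_eq_mul] at this
      simp only [Pi.sub_apply]
      linarith
    have hsum : ∑ j, (y - x) j = 0 := by
      simp only [Pi.sub_apply, sum_sub_distrib, hx.2, hy.2, sub_self]
    have hline : StrictConvexOn ℝ (Set.Icc (0 : ℝ) 1)
        (fun t : ℝ => fisherInfo G ω (fun j => x j + t * (y - x) j)) := by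
      refine strictConvexOn_of_deriv2_pos (convex_Icc 0 1) (fun t ht =>
        (hasDerivAt_fisherInfo_line G ω (hpos t ht)).continuousAt.continuousWithinAt)
        fun t ht => ?_
      have hpt := hpos t (interior_subset ht)
      simp only [Function.iterate_succ, Function.iterate_zero, Function.comp_apply, id]
      rw [deriv_deriv_fisherInfo_line G ω hpt]
      exact fisherInfoHess_pos hconn hωpos hpt (sub_ne_zero.2 hxy.symm) hsum
    have key := hline.2 (Set.left_mem_Icc.2 zero_le_one) (Set.right_mem_Icc.2 zero_le_one)
      zero_ne_one ha hb hab
    have hcomb : (fun j => x j + b * (y - x) j) = a • x + b • y := by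
      funext j
      simp only [Pi.sub_apply, Pi.add_apply, Pi.smul_apply, smul_eq_mul]
      rw [← eq_sub_iff_add_eq] at hab
      rw [hab]
      ring
    simpa [← hcomb] using key
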